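/- Let A ∈ M_n(ℂ) be such that its first n−1 rows are linearly independent and e_n·e_n = b (e_1·e_1) for some b ∈ ℂ with b ≠ 0. Let d be a derivation of E(A) with matrix entries d_{ij}. If d_{1n} = 0, then d = 0. -/

import Mathlib

open Matrix Polynomial Finset

/-- The multiplication of the evolution algebra `E(A)` on `ℂ^n` associated to the
matrix `A`: it is the unique commutative bilinear multiplication with
`e i · e j = 0` for `i ≠ j` and `e i · e i = ∑ k, A i k • e k`, where `e i = Pi.single i 1`
is the standard (natural) basis. -/
noncomputable def evolMul {n : ℕ} (A : Matrix (Fin n) (Fin n) ℂ) (u v : Fin n → ℂ) : Fin n → ℂ :=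
  fun k => ∑ i, u i * v i * A i k

/-- A linear map `d : E(A) → E(A)` is a derivation if `d (u·v) = d u · v + u · d v`. -/
def IsEvolDerivation {n : ℕ} (A : Matrix (Fin n) (Fin n) ℂ)
    (d : (Fin n → ℂ) →ₗ[ℂ] (Fin n → ℂ)) : Prop :=
  ∀ u v : Fin n → ℂ, d (evolMul A u v) = evolMul A (d u) v + evolMul A u (d v)

lemma evolMul_comm {n : ℕ} (A : Matrix (Fin n) (Fin n) ℂ) (u v : Fin n → ℂ) :
    evolMul A u v = evolMul A v u := by
  funext k
  simp only [evolMul, mul_comm (u _)]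

lemma evolMul_single_right {n : ℕ} (A : Matrix (Fin n) (Fin n) ℂ) (u : Fin n → ℂ) (j : Fin n) :
    evolMul A u (Pi.single j 1) = u j • A j := by
  funext k
  simp [evolMul, Pi.single_apply]

lemma evolMul_single_left {n : ℕ} (A : Matrix (Fin n) (Fin n) ℂ) (u : Fin n → ℂ) (j : Fin n) :
    evolMul A (Pi.single j 1) u = u j • A j := by
  rw [evolMul_comm, evolMul_single_right]

/-- The derivation identity on two distinct natural basis vectors. -/
lemma IsEvolDerivation.offDiag {n : ℕ} {A : Matrix (Fin n) (Fin n) ℂ}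
    {d : (Fin n → ℂ) →ₗ[ℂ] (Fin n → ℂ)} (hd : IsEvolDerivation A d) {i j : Fin n} (hij : i ≠ j) :
    d (Pi.single i 1) j • A j + d (Pi.single j 1) i • A i = 0 := by
  have h := hd (Pi.single i 1) (Pi.single j 1)
  simpa [evolMul_single_right, evolMul_single_left, hij.symm, eq_comm] using h

/-- The derivation identity on the square of a natural basis vector. -/
lemma IsEvolDerivation.apply_row {n : ℕ} {A : Matrix (Fin n) (Fin n) ℂ}
    {d : (Fin n → ℂ) →ₗ[ℂ] (Fin n → ℂ)} (hd : IsEvolDerivation A d) (i : Fin n) :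
    d (A i) = (2 * d (Pi.single i 1) i) • A i := by
  have h := hd (Pi.single i 1) (Pi.single i 1)
  rw [evolMul_single_right, evolMul_single_right, evolMul_single_left] at h
  simpa [two_mul, add_smul] using h

/-- A derivation that is diagonal in the natural basis vanishes when no row of `A` is zero. -/
lemma IsEvolDerivation.eq_zero_of_diagonal {n : ℕ} {A : Matrix (Fin n) (Fin n) ℂ}
    {d : (Fin n → ℂ) →ₗ[ℂ] (Fin n → ℂ)} (hd : IsEvolDerivation A d) (hA : ∀ i, A i ≠ 0)
    (hdiag : ∀ i j, i ≠ j → d (Pi.single i 1) j = 0) : d = 0 := by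
  have happly (v : Fin n → ℂ) (k : Fin n) : d v k = v k * d (Pi.single k 1) k := by
    conv_lhs => rw [pi_eq_sum_univ' v]
    rw [map_sum, Finset.sum_apply, Finset.sum_eq_single k]
    · simp
    · intro i _ hik
      simp [hdiag i k hik]
    · simp
  have hdouble (i : Fin n) : ∃ k, d (Pi.single k 1) k = 2 * d (Pi.single i 1) i := by
    obtain ⟨k, hk⟩ := Function.ne_iff.mp (hA i)
    refine ⟨k, mul_left_cancel₀ hk ?_⟩
    have h := congrFun (hd.apply_row i) k
    rw [happly, Pi.smul_apply, smul_eq_mul] at h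
    rw [h, mul_comm]
  have hzero (i : Fin n) : d (Pi.single i 1) i = 0 := by
    have : Nonempty (Fin n) := ⟨i⟩
    obtain ⟨m, hm⟩ := Finite.exists_max fun i : Fin n => ‖d (Pi.single i 1) i‖
    obtain ⟨k, hk⟩ := hdouble m
    have hle := hm k
    rw [hk, norm_mul, Complex.norm_ofNat] at hle
    have hi := hm i
    exact norm_le_zero_iff.mp (by linarith)
  refine LinearMap.ext fun v => funext fun k => ?_
  rw [happly, hzero, mul_zero, LinearMap.zero_apply, Pi.zero_apply]

/-- Suppose the first `n-1` rows of `A` are linearly independent and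
`eₙ·eₙ = b (e₁·e₁)` with `b ≠ 0`.  If a derivation `d` of `E(A)` satisfies `d₁ₙ = 0`,
then `d = 0`. -/
theorem derivation_eq_zero_of_d1n_eq_zero (n : ℕ) (hn : 3 ≤ n)
    (A : Matrix (Fin n) (Fin n) ℂ)
    (hrows : LinearIndependent ℂ (fun i : Fin (n - 1) => A (Fin.castLE (Nat.sub_le n 1) i)))
    (b : ℂ) (hb : b ≠ 0)
    (hlast : evolMul A (Pi.single (⟨n - 1, by omega⟩ : Fin n) 1)
        (Pi.single (⟨n - 1, by omega⟩ : Fin n) 1)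
      = b • evolMul A (Pi.single (⟨0, by omega⟩ : Fin n) 1)
          (Pi.single (⟨0, by omega⟩ : Fin n) 1))
    (d : (Fin n → ℂ) →ₗ[ℂ] (Fin n → ℂ)) (hd : IsEvolDerivation A d)
    (h1n : d (Pi.single (⟨0, by omega⟩ : Fin n) 1) (⟨n - 1, by omega⟩ : Fin n) = 0) :
    d = 0 := by
  set z : Fin n := ⟨0, by omega⟩ with hz
  set l : Fin n := ⟨n - 1, by omega⟩ with hl
  have hAl : A l = b • A z := by
    simpa [evolMul_single_right] using hlast
  have hzl : z ≠ l := by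
    simp only [hz, hl, ne_eq, Fin.mk.injEq]
    omega
  have hne (i : Fin n) (hi : i ≠ l) : A i ≠ 0 := by
    have hi' : (i : ℕ) ≠ n - 1 := fun h => hi (Fin.ext h)
    exact hrows.ne_zero ⟨i, by omega⟩
  have hindep (i j : Fin n) (hi : i ≠ l) (hj : j ≠ l) (hij : i ≠ j) (s t : ℂ)
      (h : s • A i + t • A j = 0) : s = 0 ∧ t = 0 := by
    have hi' : (i : ℕ) ≠ n - 1 := fun h => hi (Fin.ext h)
    have hj' : (j : ℕ) ≠ n - 1 := fun h => hj (Fin.ext h)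
    have hij' : (⟨i, by omega⟩ : Fin (n - 1)) ≠ ⟨j, by omega⟩ := fun h =>
      hij (Fin.ext (Fin.mk.inj h))
    have heq : ![A i, A j] = (fun i : Fin (n - 1) => A (Fin.castLE (Nat.sub_le n 1) i)) ∘
        ![⟨i, by omega⟩, ⟨j, by omega⟩] := by
      funext x
      fin_cases x <;> rfl
    have hpair : LinearIndependent ℂ ![A i, A j] :=
      heq ▸ hrows.comp _ (injective_pair_iff_ne.mpr hij')
    exact LinearIndependent.pair_iff.mp hpair s t h
  have hlast_pair (j : Fin n) (hj : j ≠ l) :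
      d (Pi.single l 1) j = 0 ∧ d (Pi.single j 1) l = 0 := by
    have h := hd.offDiag hj
    rw [hAl, smul_smul] at h
    by_cases hjz : j = z
    · subst hjz
      rw [h1n, zero_mul, zero_smul, zero_add] at h
      exact ⟨(smul_eq_zero.mp h).resolve_right (hne _ hj), h1n⟩
    · obtain ⟨h₁, h₂⟩ := hindep z j hzl hj (Ne.symm hjz) _ _ h
      exact ⟨h₂, (mul_eq_zero.mp h₁).resolve_right hb⟩
  refine hd.eq_zero_of_diagonal (fun i => ?_) (fun i j hij => ?_)
  · by_cases hi : i = l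
    · rw [hi, hAl]
      exact smul_ne_zero hb (hne z hzl)
    · exact hne i hi
  · by_cases hi : i = l
    · subst hi
      exact (hlast_pair j hij.symm).1
    · by_cases hj : j = l
      · subst hj
        exact (hlast_pair i hi).2
      · exact (hindep j i hj hi hij.symm _ _ (hd.offDiag hij)).1
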